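/- Let ℓ > 0 and let u : ℝ² → ℝ² be a C² function that is ℓ-periodic in each coordinate, and let ω = ∂₁u₂ − ∂₂u₁. Then ‖ω‖²_{L²([0,ℓ]²)} ≤ ‖u‖_{L²([0,ℓ]²)} · ‖∇ω‖_{L²([0,ℓ]²)}, where ‖∇ω‖²_{L²} = ∫_{[0,ℓ]²} (|∂₁ω|² + |∂₂ω|²) dx. -/

import Mathlib

open MeasureTheory

/-- Partial derivative `∂ᵢ h` of a scalar function on `ℝ²`. -/
noncomputable def pd (i : Fin 2) (h : (Fin 2 → ℝ) → ℝ) (x : Fin 2 → ℝ) : ℝ :=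
  fderiv ℝ h x (Pi.single i 1)

/-- The integral over a period cell of the divergence of a periodic `C¹` vector field vanishes. -/
theorem integral_divergence_eq_zero_of_periodic {n : ℕ} {ℓ : ℝ} (hℓ : 0 ≤ ℓ)
    (f : Fin (n + 1) → (Fin (n + 1) → ℝ) → ℝ) (hf : ∀ i, ContDiff ℝ 1 (f i))
    (hper : ∀ i x, f i (x + ℓ • (Pi.single i 1 : Fin (n + 1) → ℝ)) = f i x) :
    ∫ x in Set.Icc (0 : Fin (n + 1) → ℝ) (fun _ => ℓ),
      ∑ i, fderiv ℝ (f i) x (Pi.single i 1) = 0 := by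
  have hcont : Continuous fun x => ∑ i, fderiv ℝ (f i) x (Pi.single i 1) :=
    continuous_finsetSum _ fun i _ =>
      ((hf i).continuous_fderiv one_ne_zero).clm_apply continuous_const
  rw [integral_divergence_of_hasFDerivAt_off_countable' (0 : Fin (n + 1) → ℝ) (fun _ => ℓ)
    (fun _ => hℓ) f (fun i => fderiv ℝ (f i)) ∅ Set.countable_empty
    (fun i => (hf i).continuous.continuousOn)
    (fun x _ i => ((hf i).differentiable one_ne_zero x).hasFDerivAt)
    (hcont.continuousOn.integrableOn_compact isCompact_Icc)]
  refine Finset.sum_eq_zero fun i _ => sub_eq_zero.2 ?_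
  refine integral_congr_ae (Filter.Eventually.of_forall fun x => ?_)
  have hface : (Fin.insertNth i ℓ x : Fin (n + 1) → ℝ)
      = Fin.insertNth i 0 x + ℓ • (Pi.single i 1 : Fin (n + 1) → ℝ) := by
    ext j
    refine Fin.succAboveCases i ?_ (fun k => ?_) j <;> simp
  simpa [hface] using hper i (Fin.insertNth i 0 x)

/-- Cauchy–Schwarz for continuous planar vector fields on a compact set. -/
theorem setIntegral_dot_le_sqrt_mul_sqrt {X : Type*} [TopologicalSpace X] [T2Space X]
    [MeasurableSpace X] [OpensMeasurableSpace X] {μ : Measure X} [IsFiniteMeasureOnCompacts μ]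
    {K : Set X} (hK : IsCompact K) {a b c d : X → ℝ} (ha : Continuous a) (hb : Continuous b)
    (hc : Continuous c) (hd : Continuous d) :
    ∫ x in K, (a x * c x + b x * d x) ∂μ
      ≤ Real.sqrt (∫ x in K, (a x ^ 2 + b x ^ 2) ∂μ)
        * Real.sqrt (∫ x in K, (c x ^ 2 + d x ^ 2) ∂μ) := by
  have hint : ∀ {g : X → ℝ}, Continuous g → IntegrableOn g K μ := fun hg =>
    hg.continuousOn.integrableOn_compact hK
  set A := ∫ x in K, (a x ^ 2 + b x ^ 2) ∂μ
  set B := ∫ x in K, (c x ^ 2 + d x ^ 2) ∂μ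
  set I := ∫ x in K, (a x * c x + b x * d x) ∂μ
  have hquad : ∀ t : ℝ, 0 ≤ A * (t * t) + (2 * I) * t + B := fun t => by
    have h : A * (t * t) + (2 * I) * t + B
        = ∫ x in K, ((t * a x + c x) ^ 2 + (t * b x + d x) ^ 2) ∂μ := by
      rw [show A * (t * t) = ∫ x in K, (a x ^ 2 + b x ^ 2) * (t * t) ∂μ from
          (integral_mul_const _ _).symm,
        show 2 * I * t = ∫ x in K, (a x * c x + b x * d x) * (2 * t) ∂μ by
          rw [integral_mul_const]; ring,
        ← integral_add (hint (by fun_prop)) (hint (by fun_prop)),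
        ← integral_add (hint (by fun_prop)) (hint (by fun_prop))]
      congr 1 with x
      ring
    rw [h]
    exact integral_nonneg fun x => by positivity
  have hdisc := discrim_le_zero hquad
  rw [discrim] at hdisc
  rw [← Real.sqrt_mul (integral_nonneg fun x => by positivity)]
  exact Real.le_sqrt_of_sq_le (by linarith)

theorem contDiff_pd {n : WithTop ℕ∞} {h : (Fin 2 → ℝ) → ℝ} (hh : ContDiff ℝ (n + 1) h)
    (i : Fin 2) : ContDiff ℝ n (pd i h) :=
  (hh.fderiv_right le_rfl).clm_apply contDiff_const

theorem pd_add_eq_of_periodic {h : (Fin 2 → ℝ) → ℝ} {c : Fin 2 → ℝ} (hc : ∀ x, h (x + c) = h x)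
    (i : Fin 2) (x : Fin 2 → ℝ) : pd i h (x + c) = pd i h x := by
  rw [pd, ← fderiv_comp_add_right, funext hc, pd]

theorem pd_mul {g h : (Fin 2 → ℝ) → ℝ} {x : Fin 2 → ℝ} (hg : DifferentiableAt ℝ g x)
    (hh : DifferentiableAt ℝ h x) (i : Fin 2) :
    pd i (fun y => g y * h y) x = g x * pd i h x + h x * pd i g x := by
  simp [pd, fderiv_fun_mul hg hh]

/-- For an `ℓ`-periodic `C²` velocity field `u : ℝ² → ℝ²` with scalar vorticity
`ω = ∂₁u₂ − ∂₂u₁`, one has `‖ω‖²_{L²} ≤ ‖u‖_{L²} ‖∇ω‖_{L²}` over the fundamental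
domain `[0,ℓ]²`. -/
theorem enstrophy_le_velocity_mul_grad_vorticity
    (ℓ : ℝ) (hℓ : 0 < ℓ)
    (u : (Fin 2 → ℝ) → (Fin 2 → ℝ)) (hu : ContDiff ℝ 2 u)
    (hper : ∀ (x : Fin 2 → ℝ) (i : Fin 2), u (x + ℓ • (Pi.single i 1 : Fin 2 → ℝ)) = u x)
    (ω : (Fin 2 → ℝ) → ℝ)
    (hω : ω = fun x => pd 0 (fun y => u y 1) x - pd 1 (fun y => u y 0) x) :
    ∫ x in Set.Icc (0 : Fin 2 → ℝ) (fun _ => ℓ), (ω x) ^ 2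
      ≤ Real.sqrt (∫ x in Set.Icc (0 : Fin 2 → ℝ) (fun _ => ℓ), ((u x 0) ^ 2 + (u x 1) ^ 2))
        * Real.sqrt (∫ x in Set.Icc (0 : Fin 2 → ℝ) (fun _ => ℓ),
            ((pd 0 ω x) ^ 2 + (pd 1 ω x) ^ 2)) := by
  have hv : ∀ i, ContDiff ℝ 2 fun y => u y i := contDiff_pi.1 hu
  have hv1 : ∀ i, ContDiff ℝ 1 fun y => u y i := fun i => (hv i).of_le one_le_two
  have hω1 : ContDiff ℝ 1 ω := by
    rw [hω]
    exact (contDiff_pd (hv 1) 0).sub (contDiff_pd (hv 0) 1)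
  have hωper : ∀ i x, ω (x + ℓ • (Pi.single i 1 : Fin 2 → ℝ)) = ω x := fun i x => by
    simp only [hω]
    rw [pd_add_eq_of_periodic fun y => congrFun (hper y i) 1,
      pd_add_eq_of_periodic fun y => congrFun (hper y i) 0]
  have hpd : ∀ i, Continuous (pd i ω) := fun i =>
    (contDiff_pd (n := 0) (by simpa using hω1) i).continuous
  have hdiv := integral_divergence_eq_zero_of_periodic hℓ.le
    ![fun x => ω x * u x 1, fun x => ω x * -u x 0]
    (Fin.forall_fin_two.2 ⟨hω1.mul (hv1 1), hω1.mul (hv1 0).neg⟩)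
    (Fin.forall_fin_two.2 ⟨fun x => by simp [hωper, hper], fun x => by simp [hωper, hper]⟩)
  have hpointwise : ∀ x, ∑ i, fderiv ℝ ((![fun x => ω x * u x 1, fun x => ω x * -u x 0] :
      Fin 2 → (Fin 2 → ℝ) → ℝ) i) x (Pi.single i 1)
      = ω x ^ 2 - (u x 0 * pd 1 ω x + u x 1 * -pd 0 ω x) := fun x => by
    have hωx := hω1.differentiable one_ne_zero x
    have hvx := fun i => (hv1 i).differentiable one_ne_zero x
    have hneg : pd 1 (fun y => -u y 0) x = -pd 1 (fun y => u y 0) x := by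
      simp [pd, fderiv_fun_neg]
    have h0 := pd_mul hωx (hvx 1) 0
    have h1 := pd_mul hωx (hvx 0).neg 1
    have hωdef : ω x = pd 0 (fun y => u y 1) x - pd 1 (fun y => u y 0) x := congrFun hω x
    rw [Fin.sum_univ_two]
    change pd 0 (fun y => ω y * u y 1) x + pd 1 (fun y => ω y * -u y 0) x = _
    change pd 1 (fun y => ω y * -u y 0) x = ω x * pd 1 (fun y => -u y 0) x + -u x 0 * pd 1 ω x at h1
    rw [h0, h1, hneg]
    linear_combination (-ω x) * hωdef
  have hu0 := (hv 0).continuous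
  have hu1 := (hv 1).continuous
  have hp0 := hpd 0
  have hp1 := hpd 1
  have hωc := hω1.continuous
  have hint : ∀ {g : (Fin 2 → ℝ) → ℝ}, Continuous g →
      IntegrableOn g (Set.Icc (0 : Fin 2 → ℝ) fun _ => ℓ) := fun hg =>
    hg.continuousOn.integrableOn_compact isCompact_Icc
  simp_rw [hpointwise] at hdiv
  rw [integral_sub (hint (by fun_prop)) (hint (by fun_prop)), sub_eq_zero] at hdiv
  rw [hdiv]
  simpa only [Pi.neg_apply, neg_sq, add_comm (pd 1 ω _ ^ 2)] using
    setIntegral_dot_le_sqrt_mul_sqrt (μ := volume) isCompact_Icc hu0 hu1 hp1 hp0.neg
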